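/- For a positive semidefinite rank-one operator E = |e⟩⟨e| on the representation space of a unitary representation of a finite group G decomposed into irreducibles σ with dimensions d_σ and multiplicities m_σ, one has E ≤ κ Σ_{g∈G} U_g E U_g†, where κ = Σ_σ min(m_σ, d_σ) d_σ / |G|. -/

import Mathlib

open Matrix BigOperators ComplexOrder Kronecker

/-- The rank of a matrix is subadditive. -/
lemma Matrix.rank_add_le_rank_add_rank {K m n : Type*} [Field K] [Finite m] [Fintype n]
    (A B : Matrix m n K) : (A + B).rank ≤ A.rank + B.rank := by
  unfold Matrix.rank
  rw [Matrix.mulVecLin_add]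
  exact (Submodule.finrank_mono (LinearMap.range_add_le _ _)).trans
    (Submodule.finrank_add_le_finrank_add_finrank _ _)

lemma Matrix.rank_sum_le_sum_rank {K m n ι : Type*} [Field K] [Finite m] [Fintype n]
    (s : Finset ι) (A : ι → Matrix m n K) : (∑ i ∈ s, A i).rank ≤ ∑ i ∈ s, (A i).rank := by
  classical
  induction s using Finset.induction_on with
  | empty => simp
  | insert a s ha ih =>
    rw [Finset.sum_insert ha, Finset.sum_insert ha]
    exact (Matrix.rank_add_le_rank_add_rank _ _).trans (by gcongr)

/-- The rank of a matrix is at most the sum of the ranks of its column blocks. -/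
lemma Matrix.rank_le_sum_rank_submatrix_sigma {K m S : Type*} [Field K] [Finite m]
    [Fintype S] {n : S → Type*} [∀ s, Fintype (n s)] (X : Matrix m (Σ s, n s) K) :
    X.rank ≤ ∑ s, (X.submatrix id (Sigma.mk s)).rank := by
  classical
  have hX : X = ∑ s, X.submatrix id (Sigma.mk s) *
      (1 : Matrix (Σ s, n s) (Σ s, n s) K).submatrix (Sigma.mk s) id := by
    ext g x
    rw [Matrix.sum_apply]
    conv_lhs => rw [← Matrix.mul_one X, Matrix.mul_apply, Fintype.sum_sigma]
    simp only [Matrix.mul_apply, Matrix.submatrix_apply]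
    rfl
  conv_lhs => rw [hX]
  exact (Matrix.rank_sum_le_sum_rank _ _).trans
    (Finset.sum_le_sum fun s _ => Matrix.rank_mul_le_left _ _)

/-- On a space of functions on a finite set, evaluation at some point has squared norm at most
the dimension of the space divided by the number of points. -/
lemma exists_norm_apply_sq_le_finrank_div_card {G : Type*} [Fintype G] [Nonempty G]
    (V : Submodule ℂ (EuclideanSpace ℂ G)) :
    ∃ g₀, ∀ f ∈ V, ‖f g₀‖ ^ 2 ≤
      (Module.finrank ℂ V : ℝ) / Fintype.card G * ∑ g, ‖f g‖ ^ 2 := by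
  let b := stdOrthonormalBasis ℂ V
  let k : G → ℝ := fun g => ∑ i, ‖(b i : EuclideanSpace ℂ G) g‖ ^ 2
  have hk : ∑ g, k g = Module.finrank ℂ V := by
    simp only [k]
    rw [Finset.sum_comm]
    have : ∀ i, ∑ g, ‖(b i : EuclideanSpace ℂ G) g‖ ^ 2 = 1 := fun i => by
      rw [← EuclideanSpace.norm_sq_eq, ← Submodule.coe_norm, b.norm_eq_one, one_pow]
    simp [this]
  obtain ⟨g₀, -, hg₀⟩ : ∃ g ∈ Finset.univ, k g ≤ (Module.finrank ℂ V : ℝ) / Fintype.card G := by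
    apply Finset.exists_le_of_sum_le Finset.univ_nonempty
    rw [hk, Finset.sum_const, Finset.card_univ, nsmul_eq_mul]
    field_simp
    rfl
  refine ⟨g₀, fun f hf => ?_⟩
  rw [← EuclideanSpace.norm_sq_eq]
  have hrep : f g₀ = ∑ i, inner ℂ (b i) ⟨f, hf⟩ * (b i : EuclideanSpace ℂ G) g₀ := by
    have := congrArg (fun v : V => (v : EuclideanSpace ℂ G) g₀) (b.sum_repr' ⟨f, hf⟩)
    simpa using this.symm
  have hcoef : ∑ i, ‖inner ℂ (b i) (⟨f, hf⟩ : V)‖ ^ 2 = ‖f‖ ^ 2 :=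
    b.sum_sq_norm_inner_right ⟨f, hf⟩
  calc ‖f g₀‖ ^ 2
      ≤ (∑ i, ‖inner ℂ (b i) (⟨f, hf⟩ : V)‖ * ‖(b i : EuclideanSpace ℂ G) g₀‖) ^ 2 := by
        rw [hrep]
        gcongr
        exact (norm_sum_le _ _).trans_eq (by simp only [norm_mul])
    _ ≤ (∑ i, ‖inner ℂ (b i) (⟨f, hf⟩ : V)‖ ^ 2) * k g₀ := Finset.sum_mul_sq_le_sq_mul_sq _ _ _
    _ ≤ _ := by rw [hcoef, mul_comm]; gcongr

/-- For a unitary projective representation `U` and a vector `e`, the overlap of a vector with `e`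
is controlled by its overlaps with the orbit of `e`, with constant the dimension of the span of
the orbit divided by the order of the group. -/
lemma norm_dotProduct_sq_le_rank_orbit {G I : Type*} [Group G] [Fintype G] [Fintype I]
    [DecidableEq I] (U : G → Matrix I I ℂ) (hU : ∀ g, U g ∈ Matrix.unitaryGroup I ℂ)
    (c : G → G → ℂ) (hc : ∀ g h, ‖c g h‖ = 1) (hmul : ∀ g h, U g * U h = c g h • U (g * h))
    (e y : I → ℂ) :
    ‖star y ⬝ᵥ e‖ ^ 2 ≤ ((Matrix.of fun g => U g *ᵥ e).rank : ℝ) / Fintype.card G *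
      ∑ g, ‖star y ⬝ᵥ (U g *ᵥ e)‖ ^ 2 := by
  set X : Matrix G I ℂ := Matrix.of fun g => U g *ᵥ e with hX
  let φ := (WithLp.linearEquiv 2 ℂ (G → ℂ)).symm
  obtain ⟨g₀, hg₀⟩ := exists_norm_apply_sq_le_finrank_div_card
    ((LinearMap.range X.mulVecLin).map φ.toLinearMap)
  have hXv : ∀ v g, (X *ᵥ v) g = v ⬝ᵥ (U g *ᵥ e) := fun v g => dotProduct_comm _ _
  have hdag : ∀ z, star (U g₀ *ᵥ y) ⬝ᵥ z = star y ⬝ᵥ ((U g₀)ᴴ *ᵥ z) := fun z => by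
    rw [Matrix.star_mulVec, Matrix.dotProduct_mulVec]
  have hUU : (U g₀)ᴴ * U g₀ = 1 := (Matrix.mem_unitaryGroup_iff').1 (hU g₀)
  have key := hg₀ (φ (X *ᵥ star (U g₀ *ᵥ y)))
    (Submodule.mem_map_of_mem ⟨star (U g₀ *ᵥ y), rfl⟩)
  rw [LinearEquiv.finrank_map_eq] at key
  have hφ : ∀ (f : G → ℂ) g, (φ f) g = f g := fun _ _ => rfl
  simp only [hφ, hXv, hdag, Matrix.mulVec_mulVec, hUU, Matrix.one_mulVec] at key
  refine key.trans_eq ?_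
  change (X.rank : ℝ) / _ * _ = _
  congr 1
  rw [← Equiv.sum_comp (Equiv.mulLeft g₀)]
  refine Finset.sum_congr rfl fun h _ => ?_
  have : (U g₀)ᴴ * (c g₀ h • U (g₀ * h)) = U h := by
    rw [← hmul, ← mul_assoc, hUU, one_mul]
  rw [← this, Matrix.mul_smul, Matrix.smul_mulVec, dotProduct_smul, smul_eq_mul, norm_mul, hc,
    one_mul, Equiv.coe_mulLeft]

lemma star_dotProduct_vecMulVec_mulVec {I : Type*} [Fintype I] (u x : I → ℂ) :
    star x ⬝ᵥ (Matrix.vecMulVec u (star u) *ᵥ x) = ((‖star x ⬝ᵥ u‖ ^ 2 : ℝ) : ℂ) := by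
  have h : star u ⬝ᵥ x = star (star x ⬝ᵥ u) := by
    rw [Matrix.star_dotProduct]
  rw [Matrix.vecMulVec_mulVec, dotProduct_smul, h]
  simp [Complex.mul_conj, Complex.normSq_eq_norm_sq]

/-- A vector satisfying overlap inequalities gives a Loewner inequality of rank-one operators. -/
lemma posSemidef_smul_sum_conj_sub {G I : Type*} [Fintype G] [Fintype I]
    (U : G → Matrix I I ℂ) (e : I → ℂ) (κ : ℝ)
    (h : ∀ y, ‖star y ⬝ᵥ e‖ ^ 2 ≤ κ * ∑ g, ‖star y ⬝ᵥ (U g *ᵥ e)‖ ^ 2) :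
    ((κ : ℂ) • ∑ g : G, U g * Matrix.vecMulVec e (star e) * (U g)ᴴ
      - Matrix.vecMulVec e (star e)).PosSemidef := by
  have hconj : ∀ g, U g * Matrix.vecMulVec e (star e) * (U g)ᴴ =
      Matrix.vecMulVec (U g *ᵥ e) (star (U g *ᵥ e)) := fun g => by
    rw [Matrix.mul_vecMulVec, Matrix.vecMulVec_mul, Matrix.star_mulVec]
  have hherm : ∀ u : I → ℂ, (Matrix.vecMulVec u (star u)).IsHermitian := fun u => by
    rw [Matrix.IsHermitian, Matrix.conjTranspose_vecMulVec, star_star]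
  simp only [hconj]
  refine .of_dotProduct_mulVec_nonneg ?_ fun x => ?_
  · refine Matrix.IsHermitian.sub ?_ (hherm e)
    rw [Matrix.IsHermitian, Matrix.conjTranspose_smul, Matrix.conjTranspose_sum]
    simp only [(hherm _).eq]
    simp
  · rw [Matrix.sub_mulVec, dotProduct_sub, Matrix.smul_mulVec, dotProduct_smul,
      Matrix.sum_mulVec, dotProduct_sum]
    simp only [star_dotProduct_vecMulVec_mulVec, smul_eq_mul]
    rw [← Complex.ofReal_sum, ← Complex.ofReal_mul, ← Complex.ofReal_sub]
    exact Complex.zero_le_real.2 (sub_nonneg.2 (h x))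

/-- The orbit of a vector in `m` copies of a `d`-dimensional representation spans a space of
dimension at most `min m d * d`. -/
lemma rank_orbit_block_le {G : Type*} [Finite G] {m d : ℕ} (D : G → Matrix (Fin d) (Fin d) ℂ)
    (w : Fin m × Fin d → ℂ) :
    (Matrix.of fun g => ((1 : Matrix (Fin m) (Fin m) ℂ) ⊗ₖ D g) *ᵥ w).rank ≤ min m d * d := by
  have hfac : (Matrix.of fun g => ((1 : Matrix (Fin m) (Fin m) ℂ) ⊗ₖ D g) *ᵥ w) =
      (Matrix.of fun g (q : Fin d × Fin d) => D g q.1 q.2) *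
        Matrix.of fun (q : Fin d × Fin d) (p : Fin m × Fin d) =>
          if q.1 = p.2 then w (p.1, q.2) else 0 := by
    ext g p
    simp [Matrix.mul_apply, Matrix.mulVec, dotProduct, Fintype.sum_prod_type, Matrix.one_apply,
      Finset.sum_ite_irrel]
  rcases le_total m d with h | h
  · rw [min_eq_left h]
    simpa using Matrix.rank_le_card_width
      (Matrix.of fun g => ((1 : Matrix (Fin m) (Fin m) ℂ) ⊗ₖ D g) *ᵥ w)
  · rw [min_eq_right h, hfac]
    exact (Matrix.rank_mul_le_left _ _).trans ((Matrix.rank_le_card_width _).trans (by simp))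

/-- Key inequality for rank-one operators: let `U` be a unitary (projective) representation of
a finite group `G`, decomposed into irreducible components `s` of dimension `d s` with
multiplicity `m s` (so `U g` acts block-diagonally as `1_{m s} ⊗ D s g`).  Then for the
rank-one positive semidefinite operator `E = |e⟩⟨e|`,
`E ≤ κ ∑ g, U g * E * (U g)ᴴ` where `κ = ∑ s, min (m s) (d s) * d s / |G|`. -/
theorem key_inequality_rank_one {G : Type*} [Group G] [Fintype G]
    {S : Type*} [Fintype S] [DecidableEq S] (d m : S → ℕ)
    (D : ∀ s, G → Matrix (Fin (d s)) (Fin (d s)) ℂ)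
    (hdpos : ∀ s, 0 < d s)
    (hunit : ∀ s g, D s g ∈ Matrix.unitaryGroup (Fin (d s)) ℂ)
    (c : G → G → ℂ) (hc : ∀ g h, ‖c g h‖ = 1)
    (hmul : ∀ s g h, D s g * D s h = c g h • D s (g * h))
    (hirr : ∀ s, ∀ A : Matrix (Fin (d s)) (Fin (d s)) ℂ,
      (∀ g, D s g * A = A * D s g) → ∃ z : ℂ, A = z • (1 : Matrix (Fin (d s)) (Fin (d s)) ℂ))
    (e : (Σ s : S, Fin (m s) × Fin (d s)) → ℂ) :
    let U : G → Matrix (Σ s : S, Fin (m s) × Fin (d s)) (Σ s : S, Fin (m s) × Fin (d s)) ℂ :=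
      fun g => Matrix.blockDiagonal' fun s =>
        (1 : Matrix (Fin (m s)) (Fin (m s)) ℂ) ⊗ₖ D s g
    let E : Matrix (Σ s : S, Fin (m s) × Fin (d s)) (Σ s : S, Fin (m s) × Fin (d s)) ℂ :=
      Matrix.vecMulVec e (star e)
    let κ : ℝ := ∑ s, (min (m s) (d s) * d s : ℝ) / (Fintype.card G : ℝ)
    ((κ : ℂ) • ∑ g : G, U g * E * (U g)ᴴ - E).PosSemidef := by
  intro U E κ
  have hU : ∀ g, U g ∈ Matrix.unitaryGroup _ ℂ := fun g => by
    rw [Matrix.mem_unitaryGroup_iff, Matrix.star_eq_conjTranspose]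
    simp only [U]
    rw [Matrix.blockDiagonal'_conjTranspose, ← Matrix.blockDiagonal'_mul,
      ← Matrix.blockDiagonal'_one]
    congr 1
    funext s
    have hs : D s g * (D s g)ᴴ = 1 := Matrix.mem_unitaryGroup_iff.1 (hunit s g)
    rw [Matrix.conjTranspose_kronecker, ← Matrix.mul_kronecker_mul, hs]
    simp
  have hUmul : ∀ g h, U g * U h = c g h • U (g * h) := fun g h => by
    simp only [U]
    rw [← Matrix.blockDiagonal'_mul, ← Matrix.blockDiagonal'_smul]
    congr 1
    funext s
    simp [← Matrix.mul_kronecker_mul, hmul, Matrix.kronecker_smul]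
  refine posSemidef_smul_sum_conj_sub U e κ fun y =>
    (norm_dotProduct_sq_le_rank_orbit U hU c hc hUmul e y).trans ?_
  refine mul_le_mul_of_nonneg_right ?_ (by positivity)
  have hrank : (Matrix.of fun g => U g *ᵥ e).rank ≤ ∑ s, min (m s) (d s) * d s :=
    (Matrix.rank_le_sum_rank_submatrix_sigma _).trans
      (Finset.sum_le_sum fun s _ => ?_)
  · simp only [κ]
    rw [← Finset.sum_div]
    gcongr
    exact_mod_cast hrank
  · have hblock : (Matrix.of fun g => U g *ᵥ e).submatrix id (Sigma.mk s) =
        Matrix.of fun g => ((1 : Matrix (Fin (m s)) (Fin (m s)) ℂ) ⊗ₖ D s g) *ᵥ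
          fun p => e ⟨s, p⟩ := by
      ext g p
      simp only [Matrix.submatrix_apply, Matrix.of_apply, id, Matrix.mulVec, dotProduct, U]
      rw [Fintype.sum_sigma, Finset.sum_eq_single s]
      · simp only [Matrix.blockDiagonal'_apply_eq]
      · intro t _ ht
        exact Finset.sum_eq_zero fun q _ => by
          rw [Matrix.blockDiagonal'_apply_ne _ _ _ ht.symm, zero_mul]
      · simp
    rw [hblock]
    exact rank_orbit_block_le _ _
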